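/- Let P_1 and P_2 be countable sets and H a countable set of feature vectors. There exists a function s: (ℝ_{≥0} × H) × (ℝ_{≥0} × H) → ℝ such that the map (P_1, P_2) ↦ Σ_{p1 ∈ P_1, p2 ∈ P_2} s(p1, p2) is injective on pairs of finite multisets (P_1, P_2) of elements drawn from the two countable sets with |P_1| = |P_2| bounded by a fixed N. -/

import Mathlib

/-- A sum of powers of a transcendental element determines the multiset of exponents. -/
theorem Transcendental.multiset_sum_pow_injective {R : Type*} [Ring R] {t : R}
    (ht : Transcendental ℤ t) :
    Function.Injective fun M : Multiset ℕ => (M.map (t ^ ·)).sum := by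
  intro M M' h
  let q : Multiset ℕ → Polynomial ℤ := fun M => (M.map (Polynomial.X ^ ·)).sum
  have aeval_q (M) : Polynomial.aeval t (q M) = (M.map (t ^ ·)).sum := by
    simp [q, map_multiset_sum, Multiset.map_map]
  have coeff_q (M n) : (q M).coeff n = M.count n := by
    induction M using Multiset.induction_on with
    | empty => simp [q]
    | cons a M ih =>
      simp only [q, Multiset.map_cons, Multiset.sum_cons, Polynomial.coeff_add,
        Polynomial.coeff_X_pow, Multiset.count_cons] at ih ⊢
      rw [ih]
      push_cast
      ring
  have hq : q M = q M' := transcendental_iff_injective.mp ht (by simpa only [aeval_q] using h)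
  ext n
  exact_mod_cast (coeff_q M n).symm.trans (hq ▸ coeff_q M' n)

theorem Multiset.eq_of_map_eq_of_injOn {α β : Type*} {f : α → β} {S : Set α}
    (hf : Set.InjOn f S) {M M' : Multiset α} (hM : ∀ x ∈ M, x ∈ S) (hM' : ∀ x ∈ M', x ∈ S)
    (h : M.map f = M'.map f) : M = M' := by
  rcases isEmpty_or_nonempty α with _ | _
  · exact Subsingleton.elim _ _
  have key {M : Multiset α} (hM : ∀ x ∈ M, x ∈ S) :
      (M.map f).map (Function.invFunOn f S) = M := by
    rw [Multiset.map_map]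
    exact (Multiset.map_congr rfl fun x hx => hf.leftInvOn_invFunOn (hM x hx)).trans
      (Multiset.map_id M)
  rw [← key hM, h, key hM']

theorem Multiset.map_fst_product {α β : Type*} (P : Multiset α) (Q : Multiset β) :
    (P ×ˢ Q).map Prod.fst = card Q • P := by
  induction P using Multiset.induction_on with
  | empty => simp
  | cons a P ih =>
    rw [Multiset.cons_product, Multiset.map_add, ih, Multiset.map_map,
      ← Multiset.singleton_add, nsmul_add, Multiset.nsmul_singleton]
    simp

theorem Multiset.map_snd_product {α β : Type*} (P : Multiset α) (Q : Multiset β) :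
    (P ×ˢ Q).map Prod.snd = card P • Q := by
  induction P using Multiset.induction_on with
  | empty => simp
  | cons a P ih =>
    rw [Multiset.cons_product, Multiset.map_add, ih, Multiset.map_map]
    simp [add_nsmul, add_comm]

theorem Multiset.sum_map_product {α β R : Type*} [AddCommMonoid R] (P : Multiset α)
    (Q : Multiset β) (s : α × β → R) :
    ((P ×ˢ Q).map s).sum = (P.map fun p => (Q.map fun q => s (p, q)).sum).sum := by
  induction P using Multiset.induction_on with
  | empty => simp
  | cons a P ih => simp [ih]

theorem Multiset.eq_and_eq_of_product_eq {α β : Type*} {P Q : Multiset α} {P' Q' : Multiset β}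
    (hP : card P = card P') (hQ : card Q = card Q') (h : P ×ˢ P' = Q ×ˢ Q') :
    P = Q ∧ P' = Q' := by
  have hcard : card P = card Q := by
    have := congrArg card h
    rw [Multiset.card_product, Multiset.card_product, ← hP, ← hQ] at this
    exact Nat.mul_self_inj.mp this
  have hfst := congrArg (Multiset.map Prod.fst) h
  have hsnd := congrArg (Multiset.map Prod.snd) h
  rw [map_fst_product, map_fst_product, ← hP, ← hQ, ← hcard] at hfst
  rw [map_snd_product, map_snd_product, ← hcard] at hsnd
  rcases Nat.eq_zero_or_pos (card P) with h0 | hpos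
  · rw [h0] at hP hcard
    rw [← hcard] at hQ
    simp_all [Multiset.card_eq_zero, eq_comm]
  · classical
    constructor
    · ext a
      simpa [hpos.ne'] using congrArg (Multiset.count a) hfst
    · ext a
      simpa [hpos.ne'] using congrArg (Multiset.count a) hsnd

/-- For finite multisets of (nonnegative-weight, feature) pairs drawn from countable ground
sets `𝒫₁`, `𝒫₂` (with a countable feature set `H`), there is a pairwise scoring function `s`
such that the double sum `Σ_{p₁ ∈ P₁, p₂ ∈ P₂} s(p₁, p₂)` is injective on pairs of multisets
`(P₁, P₂)` with `|P₁| = |P₂|` bounded by a fixed `N`. -/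
theorem exists_injective_pairwise_sum {H : Type*} [Countable H]
    (𝒫₁ 𝒫₂ : Set (NNReal × H)) (h₁ : 𝒫₁.Countable) (h₂ : 𝒫₂.Countable) (N : ℕ) :
    ∃ s : (NNReal × H) × (NNReal × H) → ℝ,
      ∀ P₁ P₂ Q₁ Q₂ : Multiset (NNReal × H),
        (∀ x ∈ P₁, x ∈ 𝒫₁) → (∀ x ∈ P₂, x ∈ 𝒫₂) →
        (∀ x ∈ Q₁, x ∈ 𝒫₁) → (∀ x ∈ Q₂, x ∈ 𝒫₂) →
        Multiset.card P₁ = Multiset.card P₂ → Multiset.card Q₁ = Multiset.card Q₂ →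
        Multiset.card P₁ ≤ N → Multiset.card Q₁ ≤ N →
        (P₁.map (fun p₁ => (P₂.map (fun p₂ => s (p₁, p₂))).sum)).sum
          = (Q₁.map (fun p₁ => (Q₂.map (fun p₂ => s (p₁, p₂))).sum)).sum →
        P₁ = Q₁ ∧ P₂ = Q₂ := by
  obtain ⟨f, hf⟩ := Set.countable_iff_exists_injOn.mp (h₁.prod h₂)
  have ht : Transcendental ℤ (liouvilleNumber 2) := by
    exact_mod_cast transcendental_liouvilleNumber (m := 2) le_rfl
  refine ⟨fun p => liouvilleNumber 2 ^ f p, fun P₁ P₂ Q₁ Q₂ hP₁ hP₂ hQ₁ hQ₂ hP hQ _ _ h => ?_⟩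
  refine Multiset.eq_and_eq_of_product_eq hP hQ (Multiset.eq_of_map_eq_of_injOn hf ?_ ?_ ?_)
  · rintro ⟨a, b⟩ hx
    rw [Multiset.mem_product] at hx
    exact ⟨hP₁ a hx.1, hP₂ b hx.2⟩
  · rintro ⟨a, b⟩ hx
    rw [Multiset.mem_product] at hx
    exact ⟨hQ₁ a hx.1, hQ₂ b hx.2⟩
  · apply ht.multiset_sum_pow_injective
    simp only [Multiset.map_map, Function.comp_def]
    rw [Multiset.sum_map_product, Multiset.sum_map_product]
    exact h
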